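/- Let n ≥ 2 be an integer. Every topological group automorphism γ of SU_n has either the form γ(B) = h₀·B·h₀^{-1} for all B ∈ SU_n, or the form γ(B) = h₀·B̄·h₀^{-1} for all B ∈ SU_n, for some fixed h₀ ∈ SU_n, where B̄ denotes the entrywise complex conjugate of B. -/

import Mathlib

noncomputable section

open Matrix

/-- Every unitary matrix of positive size can be rescaled to have determinant one. -/
theorem Matrix.exists_smul_mem_specialUnitaryGroup {n : ℕ} (hn : n ≠ 0)
    {Q : Matrix (Fin n) (Fin n) ℂ} (hQ : Q ∈ unitaryGroup (Fin n) ℂ) :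
    ∃ c : ℂ, star c * c = 1 ∧ c • Q ∈ specialUnitaryGroup (Fin n) ℂ := by
  have hd : star Q.det * Q.det = 1 := by
    rw [← det_conjTranspose, ← det_mul, ← star_eq_conjTranspose, (mem_unitaryGroup_iff'.1 hQ),
      det_one]
  have hd0 : Q.det ≠ 0 := right_ne_zero_of_mul (hd ▸ one_ne_zero)
  obtain ⟨c, hc⟩ := IsAlgClosed.exists_pow_nat_eq (Q.det)⁻¹ (Nat.pos_of_ne_zero hn)
  have hnc : ‖c‖ = 1 := by
    have h1 : ‖Q.det‖ = 1 := by
      have h2 := congrArg norm hd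
      rw [norm_mul, norm_star, norm_one] at h2
      nlinarith [norm_nonneg Q.det]
    have h3 := congrArg norm hc
    rw [norm_pow, norm_inv, h1, inv_one] at h3
    exact (pow_eq_one_iff_of_nonneg (norm_nonneg _) hn).1 h3
  have hcc : star c * c = 1 := by
    have := Complex.conj_mul' c
    rw [hnc] at this
    simpa using this
  refine ⟨c, hcc, mem_specialUnitaryGroup_iff.2 ⟨?_, ?_⟩⟩
  · rw [mem_unitaryGroup_iff', star_smul, smul_mul_smul_comm, hcc, mem_unitaryGroup_iff'.1 hQ,
      one_smul]
  · rw [det_smul, Fintype.card_fin, hc, inv_mul_cancel₀ hd0]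

/-- A Cayley transform argument: every unitary matrix has an orthonormal eigenbasis. -/
theorem Matrix.exists_unitary_mul_eq_mul_diagonal {n : ℕ}
    {U : Matrix (Fin n) (Fin n) ℂ} (hU : U ∈ unitaryGroup (Fin n) ℂ) :
    ∃ Q ∈ unitaryGroup (Fin n) ℂ, ∃ d : Fin n → ℂ, U * Q = Q * diagonal d := by
  obtain ⟨θ, hθ, hθU⟩ : ∃ θ : ℂ, ‖θ‖ = 1 ∧ (scalar (Fin n) θ - U).det ≠ 0 := by
    have hinf : (Metric.sphere (0 : ℂ) 1).Infinite := by
      apply IsPreconnected.infinite_of_nontrivial (isPreconnected_sphere (by simp) _ _)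
      exact ⟨1, by simp, -1, by simp, by norm_num⟩
    obtain ⟨θ, h1, h2⟩ := hinf.exists_notMem_finset (U.charpoly.roots.toFinset)
    refine ⟨θ, by simpa using h1, fun h => h2 ?_⟩
    rw [Multiset.mem_toFinset, Polynomial.mem_roots U.charpoly_monic.ne_zero, Polynomial.IsRoot,
      eval_charpoly, h]
  have hθθ : star θ * θ = 1 := by
    have := Complex.conj_mul' θ
    rw [hθ] at this
    simpa using this
  set A := scalar (Fin n) θ - U with hA
  set B := scalar (Fin n) θ + U with hB
  have hunit : IsUnit A.det := isUnit_iff_ne_zero.2 hθU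
  have hsU : star U * U = 1 := mem_unitaryGroup_iff'.1 hU
  have hUs : U * star U = 1 := mem_unitaryGroup_iff.1 hU
  set H : Matrix (Fin n) (Fin n) ℂ := Complex.I • (A⁻¹ * B) with hH
  have hAu : IsUnit A := (isUnit_iff_isUnit_det _).2 hunit
  have hss : scalar (Fin n) θ * star (scalar (Fin n) θ) = 1 := by
    rw [mul_eq_one_comm, scalar_apply, star_eq_conjTranspose, diagonal_conjTranspose,
      diagonal_mul_diagonal, ← diagonal_one]
    exact congrArg _ (funext fun _ => hθθ)
  have hAH : A * H = Complex.I • B := by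
    rw [hH, mul_smul_comm, ← mul_assoc, mul_nonsing_inv _ hunit, one_mul]
  have hHherm : H.IsHermitian := by
    have h1 : B * star A = - (A * star B) := by
      simp only [hA, hB, star_add, star_sub, add_mul, sub_mul, mul_add, mul_sub, hss, hUs]
      abel
    have h2 : star H * star A = -(Complex.I • star B) := by
      rw [← star_mul, hAH, star_smul, Complex.star_def, Complex.conj_I, neg_smul]
    refine (hAu.mul_left_cancel (hAu.star.mul_right_cancel ?_) : star H = H)
    rw [mul_assoc, h2, hAH, smul_mul_assoc, h1, mul_neg, mul_smul_comm, smul_neg]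
  have hne : ∀ j, (hHherm.eigenvalues j : ℂ) + Complex.I ≠ 0 := fun j h => by
    simpa using congrArg Complex.im h
  refine ⟨hHherm.eigenvectorUnitary.1, hHherm.eigenvectorUnitary.2,
    fun j => θ * ((hHherm.eigenvalues j - Complex.I) / (hHherm.eigenvalues j + Complex.I)), ?_⟩
  set Q : Matrix (Fin n) (Fin n) ℂ := hHherm.eigenvectorUnitary.1
  have hHQ : H * Q = Q * diagonal (fun j => (hHherm.eigenvalues j : ℂ)) := by
    have h1 := hHherm.spectral_theorem
    rw [Unitary.conjStarAlgAut_apply] at h1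
    conv_lhs => rw [h1]
    rw [mul_assoc, Unitary.coe_star_mul_self, mul_one]
    rfl
  have hBQ : Complex.I • (B * Q) = A * Q * diagonal (fun j => (hHherm.eigenvalues j : ℂ)) := by
    rw [← smul_mul_assoc, ← hAH, mul_assoc, hHQ, mul_assoc]
  ext i j
  have h1 := congrFun (congrFun hBQ i) j
  simp only [hA, hB, add_mul, sub_mul, smul_apply, add_apply, sub_apply, mul_diagonal,
    scalar_apply, diagonal_mul, smul_eq_mul] at h1
  rw [mul_diagonal, ← mul_div_assoc, ← mul_div_assoc, eq_div_iff (hne j)]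
  linear_combination h1

/-- Every unitary matrix is diagonalized by a special unitary one. -/
theorem Matrix.exists_specialUnitary_mul_eq_mul_diagonal {n : ℕ} (hn : n ≠ 0)
    {U : Matrix (Fin n) (Fin n) ℂ} (hU : U ∈ unitaryGroup (Fin n) ℂ) :
    ∃ Q ∈ specialUnitaryGroup (Fin n) ℂ, ∃ d : Fin n → ℂ, U * Q = Q * diagonal d := by
  obtain ⟨Q, hQ, d, h⟩ := exists_unitary_mul_eq_mul_diagonal hU
  obtain ⟨c, -, hcQ⟩ := exists_smul_mem_specialUnitaryGroup hn hQ
  exact ⟨c • Q, hcQ, d, by rw [mul_smul_comm, h, smul_mul_assoc]⟩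

open scoped Matrix.Norms.L2Operator in
/-- The special unitary matrices span the full matrix algebra. -/
theorem Matrix.span_specialUnitaryGroup {n : ℕ} (hn : n ≠ 0) :
    Submodule.span ℂ (specialUnitaryGroup (Fin n) ℂ : Set (Matrix (Fin n) (Fin n) ℂ)) = ⊤ := by
  rw [eq_top_iff, ← CStarAlgebra.span_unitary, Submodule.span_le]
  intro Q hQ
  obtain ⟨c, hc, hcQ⟩ := exists_smul_mem_specialUnitaryGroup hn hQ
  have h1 := Submodule.smul_mem _ (star c) (Submodule.subset_span (R := ℂ) hcQ)
  rwa [smul_smul, hc, one_smul] at h1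

/-- A conjugation preserving the special unitary group is given by a special unitary matrix. -/
theorem Matrix.exists_specialUnitary_conj_of_isUnit {n : ℕ} (hn : n ≠ 0)
    (γ : specialUnitaryGroup (Fin n) ℂ → specialUnitaryGroup (Fin n) ℂ)
    {g : Matrix (Fin n) (Fin n) ℂ} (hg : IsUnit g)
    (hconj : ∀ B : specialUnitaryGroup (Fin n) ℂ, (γ B).1 * g = g * B.1) :
    ∃ h : specialUnitaryGroup (Fin n) ℂ, ∀ B, γ B = h * B * h⁻¹ := by
  have hsu : ∀ B : specialUnitaryGroup (Fin n) ℂ, star B.1 * B.1 = 1 := fun B =>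
    mem_unitaryGroup_iff'.1 (mem_specialUnitaryGroup_iff.1 B.2).1
  have hcomm : ∀ B : specialUnitaryGroup (Fin n) ℂ, Commute (star g * g) B.1 := by
    intro B
    have h1 : star B.1 * (star g * g) * B.1 = star g * g := by
      rw [← mul_assoc, ← star_mul, mul_assoc, ← hconj, star_mul, mul_assoc,
        ← mul_assoc _ (γ B).1, hsu, one_mul]
    have h2 : B.1 * star B.1 = 1 := mul_eq_one_comm.1 (hsu B)
    calc star g * g * B.1 = B.1 * star B.1 * (star g * g) * B.1 := by rw [h2, one_mul]
      _ = B.1 * (star B.1 * (star g * g) * B.1) := by simp only [mul_assoc]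
      _ = B.1 * (star g * g) := by rw [h1]
  have hcomm' : ∀ M : Matrix (Fin n) (Fin n) ℂ, Commute (star g * g) M := by
    intro M
    have hM : M ∈ Submodule.span ℂ
        (specialUnitaryGroup (Fin n) ℂ : Set (Matrix (Fin n) (Fin n) ℂ)) := by
      rw [span_specialUnitaryGroup hn]
      trivial
    induction hM using Submodule.span_induction with
    | mem B hB => exact hcomm ⟨B, hB⟩
    | zero => exact Commute.zero_right _
    | add A B _ _ hA hB => exact hA.add_right hB
    | smul c A _ hA => exact hA.smul_right c
  obtain ⟨c, hc⟩ := mem_range_scalar_of_commute_single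
    (M := star g * g) fun i j _ => (hcomm' _).symm
  have hcr : ∃ r : ℝ, 0 ≤ r ∧ (r : ℂ) = c := by
    let i : Fin n := ⟨0, Nat.pos_of_ne_zero hn⟩
    refine ⟨∑ k, ‖g k i‖ ^ 2, Finset.sum_nonneg fun _ _ => sq_nonneg _, ?_⟩
    have h1 := congrFun (congrFun hc i) i
    rw [scalar_apply, diagonal_apply_eq, mul_apply] at h1
    rw [h1, Complex.ofReal_sum]
    refine Finset.sum_congr rfl fun k _ => ?_
    rw [star_apply, Complex.star_def, Complex.conj_mul', Complex.ofReal_pow]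
  obtain ⟨r, hr0, rfl⟩ := hcr
  have hr : 0 < r := by
    refine lt_of_le_of_ne hr0 fun h => ?_
    have h1 : IsUnit (star g * g) := hg.star.mul hg
    rw [← hc, ← h, Complex.ofReal_zero, map_zero] at h1
    have : Nontrivial (Matrix (Fin n) (Fin n) ℂ) := by
      have : NeZero n := ⟨hn⟩
      infer_instance
    exact not_isUnit_zero h1
  set u : Matrix (Fin n) (Fin n) ℂ := ((√r)⁻¹ : ℂ) • g with hu
  have huu : u ∈ unitaryGroup (Fin n) ℂ := by
    rw [mem_unitaryGroup_iff', hu, star_smul, smul_mul_smul_comm, ← hc, scalar_apply,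
      ← diagonal_one, ← diagonal_smul]
    congr 1
    ext _
    have h1 : ((√r : ℝ) : ℂ) * (√r : ℝ) = r := by rw [← Complex.ofReal_mul, Real.mul_self_sqrt hr0]
    have h2 : ((√r : ℝ) : ℂ) ≠ 0 := by simpa using (Real.sqrt_pos.2 hr).ne'
    simp only [Pi.smul_apply, smul_eq_mul, ← h1, star_inv₀, Complex.star_def, Complex.conj_ofReal]
    field_simp
  obtain ⟨w, -, hw⟩ := exists_smul_mem_specialUnitaryGroup hn huu
  refine ⟨⟨_, hw⟩, fun B => eq_mul_inv_of_mul_eq (Subtype.ext ?_)⟩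
  change (γ B).1 * (w • u) = (w • u) * B.1
  rw [hu, mul_smul_comm, mul_smul_comm, hconj, smul_mul_assoc, smul_mul_assoc]

/-- A trace-preserving automorphism of `SU_n` is inner. -/
theorem Matrix.exists_conj_of_trace_eq {n : ℕ} (hn : n ≠ 0)
    (γ : specialUnitaryGroup (Fin n) ℂ ≃* specialUnitaryGroup (Fin n) ℂ)
    (htr : ∀ B, (γ B).1.trace = B.1.trace) :
    ∃ h : specialUnitaryGroup (Fin n) ℂ, ∀ B, γ B = h * B * h⁻¹ := by
  set ι : MonoidAlgebra ℂ (specialUnitaryGroup (Fin n) ℂ) →ₐ[ℂ] Matrix (Fin n) (Fin n) ℂ :=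
    MonoidAlgebra.lift ℂ _ _ (Submonoid.subtype _) with hι
  set κ : MonoidAlgebra ℂ (specialUnitaryGroup (Fin n) ℂ) →ₐ[ℂ] Matrix (Fin n) (Fin n) ℂ :=
    MonoidAlgebra.lift ℂ _ _ ((Submonoid.subtype _).comp γ.toMonoidHom) with hκ
  have hιof : ∀ B : specialUnitaryGroup (Fin n) ℂ,
      ι (MonoidAlgebra.of ℂ (specialUnitaryGroup (Fin n) ℂ) B) = B.1 := fun B => by simp [hι]
  have hκof : ∀ B : specialUnitaryGroup (Fin n) ℂ,
      κ (MonoidAlgebra.of ℂ (specialUnitaryGroup (Fin n) ℂ) B) = (γ B).1 := fun B => by simp [hκ]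
  have hιs : Function.Surjective ι := by
    rw [← AlgHom.range_eq_top, ← Algebra.toSubmodule_eq_top, eq_top_iff,
      ← span_specialUnitaryGroup hn, Submodule.span_le]
    exact fun B hB => ⟨MonoidAlgebra.of ℂ (specialUnitaryGroup (Fin n) ℂ) ⟨B, hB⟩, hιof _⟩
  have hκs : Function.Surjective κ := by
    rw [← AlgHom.range_eq_top, ← Algebra.toSubmodule_eq_top, eq_top_iff,
      ← span_specialUnitaryGroup hn, Submodule.span_le]
    refine fun B hB => ⟨MonoidAlgebra.of ℂ (specialUnitaryGroup (Fin n) ℂ) (γ.symm ⟨B, hB⟩), ?_⟩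
    exact (hκof _).trans (by simp)
  have htrace : ∀ x, (κ x).trace = (ι x).trace := by
    intro x
    induction x using MonoidAlgebra.induction_on with
    | of B => rw [hιof, hκof, htr]
    | add f g hf hg => rw [map_add, map_add, trace_add, trace_add, hf, hg]
    | smul r f hf => rw [map_smul, map_smul, trace_smul, trace_smul, hf]
  have hker : ∀ x, ι x = 0 → κ x = 0 := by
    intro x hx
    rw [ext_iff_trace_mul_left]
    intro M
    obtain ⟨y, rfl⟩ := hκs M
    rw [← map_mul, htrace, map_mul, hx, mul_zero, mul_zero]
  set φ : Matrix (Fin n) (Fin n) ℂ →ₐ[ℂ] Matrix (Fin n) (Fin n) ℂ :=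
    (Ideal.Quotient.liftₐ (RingHom.ker ι) κ hker).comp
      (Ideal.quotientKerAlgEquivOfSurjective hιs).symm.toAlgHom with hφ
  have hφι : ∀ x, φ (ι x) = κ x := by
    intro x
    have h1 : (Ideal.quotientKerAlgEquivOfSurjective hιs).symm (ι x) =
        Ideal.Quotient.mk (RingHom.ker ι) x := by
      rw [AlgEquiv.symm_apply_eq]
      rfl
    change Ideal.Quotient.liftₐ (RingHom.ker ι) κ hker
      ((Ideal.quotientKerAlgEquivOfSurjective hιs).symm (ι x)) = _
    rw [h1]
    rfl
  have hφs : Function.Surjective φ := fun M => by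
    obtain ⟨y, rfl⟩ := hκs M
    exact ⟨ι y, hφι y⟩
  have hφi : Function.Injective φ :=
    (LinearMap.injective_iff_surjective (f := φ.toLinearMap)).2 hφs
  set e := AlgEquiv.ofBijective φ ⟨hφi, hφs⟩ with he
  obtain ⟨T, hT⟩ := ((Matrix.toLinAlgEquiv' (R := ℂ) (n := Fin n)).symm.trans
    (e.trans Matrix.toLinAlgEquiv')).eq_linearEquivConjAlgEquiv
  set g : Matrix (Fin n) (Fin n) ℂ := Matrix.toLinAlgEquiv'.symm T.toLinearMap with hg
  have hgu : IsUnit g := by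
    refine IsUnit.of_mul_eq_one (Matrix.toLinAlgEquiv'.symm T.symm.toLinearMap) ?_
    rw [hg, ← map_mul]
    have : (T.toLinearMap * T.symm.toLinearMap : Module.End ℂ (Fin n → ℂ)) = 1 := by
      ext; simp
    rw [this, map_one]
  have hconj : ∀ B : specialUnitaryGroup (Fin n) ℂ, (γ B).1 * g = g * B.1 := by
    intro B
    have h1 := congrArg (fun f => f (Matrix.toLinAlgEquiv' B.1)) hT
    simp only [AlgEquiv.trans_apply, AlgEquiv.symm_apply_apply,
      LinearEquiv.conjAlgEquiv_apply] at h1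
    have h2 : e B.1 = (γ B).1 := by
      rw [← hιof B, ← hκof B]
      exact hφι _
    rw [h2] at h1
    apply Matrix.toLinAlgEquiv'.injective
    rw [map_mul, map_mul, h1, hg, AlgEquiv.apply_symm_apply]
    ext; simp
  exact exists_specialUnitary_conj_of_isUnit hn γ hgu hconj

/-- A continuous unimodular character of the real line is an exponential. -/
theorem Real.exists_eq_exp_of_continuous_mul {f : ℝ → ℂ} (hf : Continuous f)
    (hadd : ∀ s t, f (s + t) = f s * f t) (hnorm : ∀ s, ‖f s‖ = 1) :
    ∃ a : ℝ, ∀ s, f s = Complex.exp (Complex.I * (a * s : ℝ)) := by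
  have hne : ∀ s, f s ≠ 0 := fun s h => by simpa [h] using hnorm s
  have h0 : f 0 = 1 := by
    have h := hadd 0 0
    rw [add_zero] at h
    exact (mul_eq_left₀ (hne 0)).1 h.symm
  set F : ℝ → ℂ := fun t => ∫ u in (0 : ℝ)..t, f u with hF
  have hFd : ∀ t, HasDerivAt F (f t) t := fun t => hf.integral_hasStrictDerivAt 0 t |>.hasDerivAt
  obtain ⟨c, hc⟩ : ∃ c, F c ≠ 0 := by
    by_contra! h
    have h1 : HasDerivAt F 0 0 := by
      rw [show F = fun _ => 0 from funext h]
      exact hasDerivAt_const _ _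
    exact hne 0 ((hFd 0).unique h1)
  have key : ∀ s, f s = (F (s + c) - F s) / F c := by
    intro s
    rw [eq_div_iff hc]
    have h1 : f s * F c = ∫ u in (0 : ℝ)..c, f (s + u) := by
      simp only [hadd, hF]
      rw [intervalIntegral.integral_const_mul]
    rw [h1, intervalIntegral.integral_comp_add_left f s, hF]
    simp only [add_zero]
    rw [intervalIntegral.integral_interval_sub_left (hf.intervalIntegrable _ _)
      (hf.intervalIntegrable _ _)]
  set l : ℂ := (f c - 1) / F c with hl
  have hfd : ∀ s, HasDerivAt f (l * f s) s := by
    intro s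
    have h1 : HasDerivAt (fun s => (F (s + c) - F s) / F c) ((f (s + c) - f s) / F c) s :=
      (((hFd (s + c)).comp_add_const s c).sub (hFd s)).div_const _
    rw [← show f = fun s => (F (s + c) - F s) / F c from funext key] at h1
    convert h1 using 1
    rw [hadd, hl]
    ring
  have hexp : ∀ s : ℝ, f s = Complex.exp (l * s) := by
    have hd : ∀ s : ℝ, HasDerivAt (fun s : ℝ => f s * Complex.exp (-(l * s))) 0 s := by
      intro s
      have h1 : HasDerivAt (fun s : ℝ => Complex.exp (-(l * s)))
          (Complex.exp (-(l * s)) * (-(l * 1))) s :=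
        ((Complex.ofRealCLM.hasDerivAt.const_mul l).neg).cexp
      exact ((hfd s).mul h1).congr_deriv (by ring)
    intro s
    have h2 := is_const_of_deriv_eq_zero (fun s => (hd s).differentiableAt)
      (fun s => (hd s).deriv) s 0
    simp only [h0, Complex.ofReal_zero, mul_zero, neg_zero, Complex.exp_zero, mul_one] at h2
    rw [Complex.exp_neg, mul_inv_eq_one₀ (Complex.exp_ne_zero _)] at h2
    exact h2
  have hre : l.re = 0 := by
    have h1 := hnorm 1
    rw [hexp, Complex.norm_exp] at h1
    simpa using h1
  refine ⟨l.im, fun s => ?_⟩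
  rw [hexp]
  congr 1
  apply Complex.ext <;> simp [hre]

/-- A nonconstant function having at most `n` rearrangements takes one value everywhere except at a
single point. -/
theorem exists_eq_update_of_card_rearrangements_le {n : ℕ} (a : Fin n → ℝ)
    (ha : ∃ i j, a i ≠ a j)
    (hcard : (Finset.univ.image fun σ : Equiv.Perm (Fin n) => a ∘ σ).card ≤ n) :
    ∃ j c d, c ≠ d ∧ a = Function.update (fun _ => c) j d := by
  classical
  set S := Finset.univ.image fun σ : Equiv.Perm (Fin n) => a ∘ σ with hS
  set C : Fin n → Finset (Fin n) := fun i => Finset.univ.filter fun k => a k = a i with hC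
  have hCpos : ∀ i, 1 ≤ (C i).card := fun i => Finset.card_pos.2 ⟨i, by simp [hC]⟩
  have hCle : ∀ i, (C i).card + 1 ≤ n := by
    intro i
    obtain ⟨k, hk⟩ : ∃ k, a k ≠ a i := by
      obtain ⟨p, q, h⟩ := ha
      by_cases hp : a p = a i
      · exact ⟨q, fun hq => h (hp.trans hq.symm)⟩
      · exact ⟨p, hp⟩
    have : C i ⊂ Finset.univ := by
      rw [Finset.ssubset_univ_iff]
      intro h
      have : k ∈ C i := h ▸ Finset.mem_univ k
      simp [hC, hk] at this
    simpa using Finset.card_lt_card this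
  have hmul : ∀ i, (C i).card * (n - (C i).card) + 1 ≤ n := by
    intro i
    have hcompl : (C i)ᶜ.card = n - (C i).card := by simp [Finset.card_compl]
    rw [← hcompl, ← Finset.card_product]
    set g : Fin n × Fin n → (Fin n → ℝ) := fun p => a ∘ Equiv.swap p.1 p.2 with hg
    have hfst : ∀ p ∈ C i ×ˢ (C i)ᶜ, ∀ k, (a k = a i ∧ g p k ≠ a i) ↔ k = p.1 := by
      rintro ⟨p, q⟩ hp k
      simp only [hC, Finset.mem_product, Finset.mem_filter, Finset.mem_univ, true_and,
        Finset.mem_compl] at hp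
      simp only [hg, Function.comp, Equiv.swap_apply_def]
      grind
    have hsnd : ∀ p ∈ C i ×ˢ (C i)ᶜ, ∀ k, (a k ≠ a i ∧ g p k = a i) ↔ k = p.2 := by
      rintro ⟨p, q⟩ hp k
      simp only [hC, Finset.mem_product, Finset.mem_filter, Finset.mem_univ, true_and,
        Finset.mem_compl] at hp
      simp only [hg, Function.comp, Equiv.swap_apply_def]
      grind
    have hinj : Set.InjOn g (C i ×ˢ (C i)ᶜ : Finset _) := by
      intro p hp q hq hpq
      have h1 := (hfst p hp p.1).2 rfl
      have h2 := (hsnd p hp p.2).2 rfl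
      rw [hpq] at h1 h2
      exact Prod.ext ((hfst q hq _).1 h1) ((hsnd q hq _).1 h2)
    rw [← Finset.card_image_of_injOn hinj]
    have hnot : a ∉ (C i ×ˢ (C i)ᶜ).image g := by
      intro h
      obtain ⟨p, hp, hpa⟩ := Finset.mem_image.1 h
      have h1 := (hfst p hp p.1).2 rfl
      rw [hpa] at h1
      exact h1.2 h1.1
    rw [← Finset.card_insert_of_notMem hnot]
    refine (Finset.card_le_card ?_).trans hcard
    intro b hb
    rcases Finset.mem_insert.1 hb with rfl | hb
    · exact Finset.mem_image.2 ⟨1, Finset.mem_univ _, rfl⟩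
    · obtain ⟨p, -, rfl⟩ := Finset.mem_image.1 hb
      exact Finset.mem_image.2 ⟨Equiv.swap p.1 p.2, Finset.mem_univ _, rfl⟩
  have hdich : ∀ i, (C i).card = 1 ∨ (C i).card + 1 = n := by
    intro i
    obtain ⟨m, hm⟩ := Nat.exists_eq_add_of_le (hCle i)
    obtain ⟨r, hr⟩ := Nat.exists_eq_add_of_le (hCpos i)
    have h := hmul i
    rw [show n - (C i).card = m + 1 by omega] at h
    have h3 : r * m ≤ 0 := by nlinarith
    rcases Nat.mul_eq_zero.1 (Nat.le_zero.1 h3) with h4 | h4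
    · left; omega
    · right; omega
  obtain ⟨i, hi⟩ : ∃ i, (C i).card + 1 = n := by
    by_contra! h
    have h1 : ∀ i, (C i).card = 1 := fun i => (hdich i).resolve_right (h i)
    have hainj : Function.Injective a := by
      intro p q hpq
      obtain ⟨r, hr⟩ := Finset.card_eq_one.1 (h1 p)
      have hp : p ∈ C p := by simp [hC]
      have hq : q ∈ C p := by simp [hC, hpq]
      rw [hr, Finset.mem_singleton] at hp hq
      rw [hp, hq]
    have hSc : S.card = n.factorial := by
      rw [hS, Finset.card_image_of_injective, Finset.card_univ, Fintype.card_perm, Fintype.card_fin]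
      intro σ τ hst
      ext k
      exact congrArg _ (hainj (congrFun hst k))
    obtain ⟨i, -, -⟩ := ha
    have h2 := h i
    have h3 := hCle i
    rw [h1 i] at h2 h3
    obtain ⟨m, rfl⟩ : ∃ m, n = m + 1 := ⟨n - 1, by omega⟩
    rw [hSc, Nat.factorial_succ] at hcard
    have h4 := Nat.self_le_factorial m
    have h5 : m.factorial ≤ 1 := Nat.le_of_mul_le_mul_left (by simpa using hcard) m.succ_pos
    omega
  have hcompl : (C i)ᶜ.card = 1 := by
    rw [Finset.card_compl, Fintype.card_fin]; omega
  obtain ⟨j, hj⟩ := Finset.card_eq_one.1 hcompl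
  have hmem : ∀ k, a k ≠ a i ↔ k = j := by
    intro k
    rw [← Finset.mem_singleton, ← hj]
    simp [hC]
  refine ⟨j, a i, a j, ((hmem j).2 rfl).symm, funext fun k => ?_⟩
  by_cases hk : k = j
  · subst hk; simp
  · rw [Function.update_of_ne hk]
    by_contra h
    exact hk ((hmem k).1 h)

/-- The diagonal special unitary matrix with angles `x j`, shifted by their mean. -/
def suTorus {n : ℕ} [NeZero n] (x : Fin n → ℝ) : specialUnitaryGroup (Fin n) ℂ :=
  ⟨diagonal fun j => Complex.exp (Complex.I * (x j - (∑ k, x k) / n : ℝ)), by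
    refine mem_specialUnitaryGroup_iff.2 ⟨?_, ?_⟩
    · rw [mem_unitaryGroup_iff', star_eq_conjTranspose, diagonal_conjTranspose,
        diagonal_mul_diagonal, ← diagonal_one]
      congr 1
      ext j
      simp only [Pi.star_apply, Complex.star_def, ← Complex.exp_conj, ← Complex.exp_add, map_mul,
        Complex.conj_I, Complex.conj_ofReal]
      simp
    · have hn : (n : ℝ) ≠ 0 := Nat.cast_ne_zero.2 (NeZero.ne n)
      rw [det_diagonal, ← Complex.exp_sum, ← Finset.mul_sum, ← Complex.ofReal_sum,
        Finset.sum_sub_distrib, Finset.sum_const, Finset.card_univ, Fintype.card_fin, nsmul_eq_mul,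
        mul_div_cancel₀ _ hn, sub_self]
      simp⟩

section

variable {n : ℕ} [NeZero n]

theorem suTorus_val (x : Fin n → ℝ) : (suTorus x).1 =
    diagonal fun j => Complex.exp (Complex.I * (x j - (∑ k, x k) / n : ℝ)) := rfl

theorem suTorus_add (x y : Fin n → ℝ) : suTorus (x + y) = suTorus x * suTorus y := by
  apply Subtype.ext
  change (suTorus (x + y)).1 = (suTorus x).1 * (suTorus y).1
  simp only [suTorus_val, diagonal_mul_diagonal, ← Complex.exp_add, ← mul_add,
    ← Complex.ofReal_add, Pi.add_apply, Finset.sum_add_distrib]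
  congr! 5
  ring

theorem continuous_suTorus : Continuous (suTorus : (Fin n → ℝ) → _) := by
  refine Continuous.subtype_mk (Continuous.matrix_diagonal ?_) _
  fun_prop

theorem suTorus_eq_one_of_const (s : ℝ) : suTorus (fun _ : Fin n => s) = 1 := by
  apply Subtype.ext
  have hn : (n : ℝ) ≠ 0 := Nat.cast_ne_zero.2 (NeZero.ne n)
  rw [suTorus_val]
  simp [mul_div_cancel_left₀ s hn, Finset.sum_const]

/-- Permutations of the angles are realized by conjugation in `SU_n`. -/
theorem exists_suTorus_comp_perm (σ : Equiv.Perm (Fin n)) :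
    ∃ P : specialUnitaryGroup (Fin n) ℂ, ∀ x, P * suTorus x = suTorus (x ∘ σ) * P := by
  have hP : σ.permMatrix ℂ ∈ unitaryGroup (Fin n) ℂ := by
    rw [mem_unitaryGroup_iff', star_eq_conjTranspose, conjTranspose_permMatrix, ← permMatrix_mul,
      mul_inv_cancel, permMatrix_one]
  obtain ⟨c, -, hc⟩ := exists_smul_mem_specialUnitaryGroup (NeZero.ne n) hP
  refine ⟨⟨_, hc⟩, fun x => Subtype.ext ?_⟩
  change (c • σ.permMatrix ℂ) * (suTorus x).1 = (suTorus (x ∘ σ)).1 * (c • σ.permMatrix ℂ)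
  rw [smul_mul_assoc, mul_smul_comm]
  congr 1
  ext i j
  simp only [suTorus_val, mul_diagonal, diagonal_mul, Equiv.Perm.permMatrix, Function.comp,
    PEquiv.toMatrix_apply, Equiv.sum_comp σ]
  by_cases h : j = σ i
  · subst h; simp
  · simp [Ne.symm h]

/-- Every special unitary matrix is conjugate to a torus element. -/
theorem exists_eq_conj_suTorus (B : specialUnitaryGroup (Fin n) ℂ) :
    ∃ (P : specialUnitaryGroup (Fin n) ℂ) (x : Fin n → ℝ), B = P * suTorus x * P⁻¹ := by
  obtain ⟨Q, hQ, d, hd⟩ := exists_specialUnitary_mul_eq_mul_diagonal (NeZero.ne n)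
    (mem_specialUnitaryGroup_iff.1 B.2).1
  set P : specialUnitaryGroup (Fin n) ℂ := ⟨Q, hQ⟩
  set D := P⁻¹ * B * P with hD
  have hDval : D.1 = diagonal d := by
    have h1 : star Q * Q = 1 := mem_unitaryGroup_iff'.1 (mem_specialUnitaryGroup_iff.1 hQ).1
    change star Q * B.1 * Q = _
    rw [mul_assoc, hd, ← mul_assoc, h1, one_mul]
  have hDmem := mem_specialUnitaryGroup_iff.1 D.2
  rw [hDval, mem_unitaryGroup_iff', star_eq_conjTranspose, diagonal_conjTranspose,
    diagonal_mul_diagonal, ← diagonal_one, diagonal_eq_diagonal_iff, det_diagonal] at hDmem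
  obtain ⟨hunit, hdet⟩ := hDmem
  have hnorm : ∀ j, ‖d j‖ = 1 := fun j => by
    have h2 := congrArg norm (hunit j)
    rw [norm_mul, Pi.star_apply, norm_star, norm_one] at h2
    nlinarith [norm_nonneg (d j)]
  have hexp : ∀ j, d j = Complex.exp (Complex.I * ((d j).arg : ℝ)) := fun j => by
    have h2 := Complex.norm_mul_exp_arg_mul_I (d j)
    rw [hnorm, Complex.ofReal_one, one_mul, mul_comm] at h2
    exact h2.symm
  obtain ⟨N, hN⟩ : ∃ N : ℤ, ∑ j, (d j).arg = N * (2 * Real.pi) := by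
    rw [Finset.prod_congr rfl fun j _ => hexp j, ← Complex.exp_sum, ← Finset.mul_sum,
      ← Complex.ofReal_sum, Complex.exp_eq_one_iff] at hdet
    obtain ⟨N, hN⟩ := hdet
    refine ⟨N, ?_⟩
    have h3 := congrArg Complex.im hN
    simpa using h3
  set x : Fin n → ℝ := fun j => (d j).arg - if j = 0 then N * (2 * Real.pi) else 0 with hx
  have hsum : ∑ j, x j = 0 := by
    simp [hx, Finset.sum_sub_distrib, hN]
  refine ⟨P, x, ?_⟩
  have hDx : D = suTorus x := by
    apply Subtype.ext
    rw [hDval, suTorus_val, hsum, diagonal_eq_diagonal_iff]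
    intro j
    rw [hexp j, zero_div, sub_zero]
    by_cases hj : j = 0
    · have h4 : Complex.I * ((x j : ℝ) : ℂ) =
          Complex.I * ((d j).arg : ℝ) - N * (2 * Real.pi * Complex.I) := by
        simp only [hx, hj, if_true]
        push_cast
        ring
      rw [h4, Complex.exp_sub, Complex.exp_int_mul_two_pi_mul_I, div_one]
    · simp [hx, hj]
  rw [← hDx, hD]
  group

/-- `a` is a weight of `γ` if the torus acts through `γ` on some nonzero vector by the
character `x ↦ exp (i ∑ a j * x j)`. -/
def IsTorusWeight (γ : specialUnitaryGroup (Fin n) ℂ ≃* specialUnitaryGroup (Fin n) ℂ)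
    (a : Fin n → ℝ) : Prop :=
  ∃ v : Fin n → ℂ, v ≠ 0 ∧ ∀ x : Fin n → ℝ,
    (γ (suTorus x)).1 *ᵥ v = Complex.exp (Complex.I * (∑ j, a j * x j : ℝ)) • v

variable {γ : specialUnitaryGroup (Fin n) ℂ ≃* specialUnitaryGroup (Fin n) ℂ}

theorem IsTorusWeight.comp_perm {a : Fin n → ℝ} (ha : IsTorusWeight γ a)
    (σ : Equiv.Perm (Fin n)) : IsTorusWeight γ (a ∘ σ) := by
  obtain ⟨v, hv, h⟩ := ha
  obtain ⟨P, hP⟩ := exists_suTorus_comp_perm σ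
  refine ⟨(γ P).1 *ᵥ v, fun h0 => hv ?_, fun x => ?_⟩
  · have h1 : (γ P⁻¹).1 * (γ P).1 = 1 := by
      change (γ P⁻¹ * γ P).1 = 1
      rw [← map_mul, inv_mul_cancel, map_one]
      rfl
    rw [← one_mulVec v, ← h1, ← mulVec_mulVec, h0, mulVec_zero]
  · have h1 : (γ (suTorus x)).1 * (γ P).1 = (γ P).1 * (γ (suTorus (x ∘ σ.symm))).1 := by
      change (γ (suTorus x) * γ P).1 = (γ P * γ (suTorus (x ∘ σ.symm))).1
      rw [← map_mul, ← map_mul, hP]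
      congr 4
      ext; simp
    rw [mulVec_mulVec, h1, ← mulVec_mulVec, h, mulVec_smul]
    congr 4
    rw [← Equiv.sum_comp σ]
    simp

theorem IsTorusWeight.sum_eq_zero {a : Fin n → ℝ} (ha : IsTorusWeight γ a) : ∑ j, a j = 0 := by
  obtain ⟨v, hv, h⟩ := ha
  by_contra hs
  have h1 := h fun _ => Real.pi / ∑ j, a j
  rw [suTorus_eq_one_of_const, map_one, ← Finset.sum_mul, mul_div_cancel₀ _ hs, mul_comm,
    Complex.exp_pi_mul_I] at h1
  change (1 : Matrix (Fin n) (Fin n) ℂ) *ᵥ v = _ at h1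
  rw [one_mulVec, neg_smul, one_smul, self_eq_neg] at h1
  exact hv h1

/-- Vectors of distinct weights are orthogonal. -/
theorem dotProduct_eq_zero_of_torusWeight_ne {a b : Fin n → ℝ} (hab : a ≠ b) {v w : Fin n → ℂ}
    (hv : ∀ x : Fin n → ℝ,
      (γ (suTorus x)).1 *ᵥ v = Complex.exp (Complex.I * (∑ j, a j * x j : ℝ)) • v)
    (hw : ∀ x : Fin n → ℝ,
      (γ (suTorus x)).1 *ᵥ w = Complex.exp (Complex.I * (∑ j, b j * x j : ℝ)) • w) :
    star v ⬝ᵥ w = 0 := by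
  obtain ⟨k, hk⟩ := Function.ne_iff.1 hab
  have hk' : b k - a k ≠ 0 := sub_ne_zero.2 (Ne.symm hk)
  set x : Fin n → ℝ := Pi.single k (Real.pi / (b k - a k)) with hx
  set U := (γ (suTorus x)).1 with hU
  have hUU : Uᴴ * U = 1 :=
    mem_unitaryGroup_iff'.1 (mem_specialUnitaryGroup_iff.1 (γ (suTorus x)).2).1
  have h1 : star (U *ᵥ v) ⬝ᵥ (U *ᵥ w) = star v ⬝ᵥ w := by
    rw [star_mulVec, ← dotProduct_mulVec, mulVec_mulVec, hUU, one_mulVec]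
  have hsum : ∀ c : Fin n → ℝ, ∑ j, c j * x j = c k * (Real.pi / (b k - a k)) := fun c => by
    rw [Finset.sum_eq_single k (fun j _ hj => by simp [hx, hj]) (by simp), hx, Pi.single_eq_same]
  rw [hv, hw, star_smul, smul_dotProduct, dotProduct_smul, smul_smul, hsum, hsum, Complex.star_def,
    ← Complex.exp_conj, ← Complex.exp_add, map_mul, Complex.conj_I, Complex.conj_ofReal,
    show -Complex.I * ((a k * (Real.pi / (b k - a k)) : ℝ) : ℂ) +
      Complex.I * ((b k * (Real.pi / (b k - a k)) : ℝ) : ℂ) = Real.pi * Complex.I by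
        rw [neg_mul, neg_add_eq_sub, ← mul_sub, ← Complex.ofReal_sub, ← sub_mul,
          mul_div_cancel₀ _ hk', mul_comm],
    Complex.exp_pi_mul_I, neg_smul, one_smul, neg_eq_self] at h1
  exact h1

open scoped ComplexOrder in
/-- Nonzero vectors of distinct weights are linearly independent. -/
theorem linearIndependent_of_torusWeights {ι : Type*} {a : ι → Fin n → ℝ}
    (ha : Function.Injective a) {v : ι → Fin n → ℂ} (hv0 : ∀ i, v i ≠ 0)
    (hv : ∀ i, ∀ x : Fin n → ℝ,
      (γ (suTorus x)).1 *ᵥ v i = Complex.exp (Complex.I * (∑ j, a i j * x j : ℝ)) • v i) :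
    LinearIndependent ℂ v := by
  rw [linearIndependent_iff']
  intro s c hc i hi
  have h1 := congrArg (fun w => star (v i) ⬝ᵥ w) hc
  simp only [dotProduct_sum, dotProduct_smul, dotProduct_zero] at h1
  rw [Finset.sum_eq_single_of_mem i hi fun j _ hj => by
    rw [dotProduct_eq_zero_of_torusWeight_ne (ha.ne hj.symm) (hv i) (hv j), smul_zero]] at h1
  exact (smul_eq_zero.1 h1).resolve_right fun h => hv0 i (dotProduct_star_self_eq_zero.1 h)

theorem card_le_of_forall_isTorusWeight (S : Finset (Fin n → ℝ))
    (hS : ∀ a ∈ S, IsTorusWeight γ a) : S.card ≤ n := by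
  choose v hv0 hv using fun a : S => hS a.1 a.2
  have := (linearIndependent_of_torusWeights Subtype.val_injective hv0 hv).fintype_card_le_finrank
  simpa using this

theorem Matrix.mulVec_eq_smul_of_mem_maxGenEigenspace {n : ℕ} {U : Matrix (Fin n) (Fin n) ℂ}
    (hU : U ∈ unitaryGroup (Fin n) ℂ) {μ : ℂ} {v : Fin n → ℂ}
    (hv : v ∈ Module.End.maxGenEigenspace (toLin' U) μ) : U *ᵥ v = μ • v := by
  obtain ⟨Q, hQ, d, hd⟩ := exists_unitary_mul_eq_mul_diagonal hU
  obtain ⟨k, hk⟩ := (Module.End.mem_maxGenEigenspace _ _ _).1 hv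
  have hQ1 : star Q * Q = 1 := mem_unitaryGroup_iff'.1 hQ
  have hQ2 : Q * star Q = 1 := mem_unitaryGroup_iff.1 hQ
  set w := star Q *ᵥ v with hw
  have hvw : v = Q *ᵥ w := by rw [hw, mulVec_mulVec, hQ2, one_mulVec]
  have hpow : ∀ k : ℕ, (((toLin' U - μ • (1 : Module.End ℂ (Fin n → ℂ))) ^ k) v) =
      Q *ᵥ fun j => (d j - μ) ^ k * w j := by
    intro k
    induction k with
    | zero => simp [← hvw]
    | succ k ih =>
      rw [pow_succ', Module.End.mul_apply, ih, LinearMap.sub_apply, toLin'_apply, mulVec_mulVec,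
        hd, ← mulVec_mulVec, LinearMap.smul_apply, Module.End.one_apply, ← mulVec_smul,
        ← mulVec_sub]
      congr 1
      ext j
      simp only [mulVec_diagonal, Pi.sub_apply, Pi.smul_apply, smul_eq_mul]
      ring
  rw [hpow k] at hk
  have h0 : (fun j => (d j - μ) ^ k * w j) = 0 := by
    have h1 := congrArg (fun u => star Q *ᵥ u) hk
    simpa only [mulVec_mulVec, hQ1, one_mulVec, mulVec_zero] using h1
  rw [hvw, mulVec_mulVec, hd, ← mulVec_mulVec, ← mulVec_smul]
  congr 1
  ext j
  have h1 := congrFun h0 j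
  rw [mulVec_diagonal, Pi.smul_apply, smul_eq_mul]
  rcases mul_eq_zero.1 h1 with h2 | h2
  · rw [sub_eq_zero.1 (eq_zero_of_pow_eq_zero h2)]
  · rw [h2, mul_zero, mul_zero]

/-- A simultaneous eigenvector of the image of the torus has a weight. -/
theorem exists_torusWeight_of_eigenvector (hγ : Continuous γ) {v : Fin n → ℂ} (hv : v ≠ 0)
    {χ : (Fin n → ℝ) → ℂ} (h : ∀ x, (γ (suTorus x)).1 *ᵥ v = χ x • v) :
    ∃ a : Fin n → ℝ, ∀ x, χ x = Complex.exp (Complex.I * (∑ j, a j * x j : ℝ)) := by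
  have hadd : ∀ x y, χ (x + y) = χ x * χ y := by
    intro x y
    have h1 := h (x + y)
    rw [suTorus_add, map_mul] at h1
    change ((γ (suTorus x)).1 * (γ (suTorus y)).1) *ᵥ v = _ at h1
    rw [← mulVec_mulVec, h, mulVec_smul, h, smul_smul] at h1
    rw [← smul_left_injective ℂ hv h1, mul_comm]
  obtain ⟨i, hi⟩ := Function.ne_iff.1 hv
  have hcont : Continuous χ := by
    have h1 : χ = fun x => ((γ (suTorus x)).1 *ᵥ v) i / v i := by
      ext x
      rw [h, Pi.smul_apply, smul_eq_mul, mul_div_cancel_right₀ _ hi]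
    rw [h1]
    exact ((continuous_apply i).comp ((continuous_subtype_val.comp
      (hγ.comp continuous_suTorus)).matrix_mulVec continuous_const)).div_const _
  have hnorm : ∀ x, ‖χ x‖ = 1 := by
    intro x
    set U := (γ (suTorus x)).1 with hU
    have hUU : Uᴴ * U = 1 :=
      mem_unitaryGroup_iff'.1 (mem_specialUnitaryGroup_iff.1 (γ (suTorus x)).2).1
    have h1 : star (U *ᵥ v) ⬝ᵥ (U *ᵥ v) = star v ⬝ᵥ v := by
      rw [star_mulVec, ← dotProduct_mulVec, mulVec_mulVec, hUU, one_mulVec]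
    have h2 : star v ⬝ᵥ v ≠ 0 := by
      open scoped ComplexOrder in exact fun h => hv (dotProduct_star_self_eq_zero.1 h)
    rw [h, star_smul, smul_dotProduct, dotProduct_smul, smul_smul, smul_eq_mul,
      mul_eq_right₀ h2] at h1
    have h3 := congrArg norm h1
    rw [norm_mul, norm_star, norm_one] at h3
    nlinarith [norm_nonneg (χ x)]
  have hsingle : ∀ j : Fin n, ∃ a : ℝ, ∀ s : ℝ,
      χ (Pi.single j s) = Complex.exp (Complex.I * (a * s : ℝ)) := fun j =>
    Real.exists_eq_exp_of_continuous_mul (f := fun s => χ (Pi.single j s))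
      (hcont.comp (continuous_single (A := fun _ => ℝ) j)) (fun s t => by rw [Pi.single_add, hadd])
      fun s => hnorm _
  choose a ha using hsingle
  refine ⟨a, fun x => ?_⟩
  have h0 : χ 0 = 1 := by
    have h1 := hadd 0 0
    rw [add_zero] at h1
    exact (mul_eq_left₀ (norm_ne_zero_iff.1 (by rw [hnorm]; exact one_ne_zero))).1 h1.symm
  have hsum : ∀ s : Finset (Fin n), χ (∑ j ∈ s, Pi.single j (x j)) =
      ∏ j ∈ s, χ (Pi.single j (x j)) := by
    intro s
    induction s using Finset.induction_on with
    | empty => simpa using h0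
    | insert j s hj ih => rw [Finset.sum_insert hj, Finset.prod_insert hj, hadd, ih]
  conv_lhs => rw [← Finset.univ_sum_single x]
  rw [hsum, Finset.prod_congr rfl fun j _ => ha j (x j), ← Complex.exp_sum, ← Finset.mul_sum,
    ← Complex.ofReal_sum]

theorem suTorus_single_sub_single {i j : Fin n} (s : ℝ) :
    suTorus (Pi.single i s - Pi.single j s) = 1 ↔
      ∀ k, Complex.exp (Complex.I * ((Pi.single i s - Pi.single j s : Fin n → ℝ) k : ℝ)) = 1 := by
  rw [← Subtype.coe_inj, suTorus_val]
  change _ = (1 : Matrix (Fin n) (Fin n) ℂ) ↔ _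
  rw [← diagonal_one, diagonal_eq_diagonal_iff]
  simp [Finset.sum_sub_distrib]

theorem suTorus_single_sub_single_eq_one_iff {i j : Fin n} (hij : i ≠ j) (s : ℝ) :
    suTorus (Pi.single i s - Pi.single j s) = 1 ↔ Complex.exp (Complex.I * s) = 1 := by
  rw [suTorus_single_sub_single]
  refine ⟨fun h => by simpa [hij] using h i, fun h k => ?_⟩
  by_cases hi : k = i
  · subst hi; simpa [hij] using h
  by_cases hj : k = j
  · subst hj; simp [hij.symm, Complex.exp_neg, h]
  · simp [hi, hj]

theorem exists_isTorusWeight_ne_zero (hn : 2 ≤ n) (hγ : Continuous γ) :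
    ∃ a, a ≠ 0 ∧ IsTorusWeight γ a := by
  by_contra! hcon
  have htop := open Module.End in
    iSup_iInf_maxGenEigenspace_eq_top_of_iSup_maxGenEigenspace_eq_top_of_commute
    (fun x : Fin n → ℝ => toLin' (γ (suTorus x)).1) (fun x y _ => by
      change toLin' _ * toLin' _ = toLin' _ * toLin' _
      rw [Module.End.mul_eq_comp, Module.End.mul_eq_comp, ← toLin'_mul, ← toLin'_mul]
      congr 1
      change (γ (suTorus x) * γ (suTorus y)).1 = (γ (suTorus y) * γ (suTorus x)).1
      rw [← map_mul, ← map_mul, ← suTorus_add, add_comm, suTorus_add])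
    fun x => Module.End.iSup_maxGenEigenspace_eq_top _
  have hfix : ∀ (x : Fin n → ℝ) (v : Fin n → ℂ), (γ (suTorus x)).1 *ᵥ v = v := by
    intro x v
    have hle : (⊤ : Submodule ℂ (Fin n → ℂ)) ≤
        Module.End.eigenspace (toLin' (γ (suTorus x)).1) 1 := by
      rw [← htop, iSup_le_iff]
      intro χ v hv
      rw [Module.End.mem_eigenspace_iff, toLin'_apply, one_smul]
      by_cases hv0 : v = 0
      · rw [hv0, mulVec_zero]
      have hev : ∀ x, (γ (suTorus x)).1 *ᵥ v = χ x • v := fun x =>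
        mulVec_eq_smul_of_mem_maxGenEigenspace
          (mem_specialUnitaryGroup_iff.1 (γ (suTorus x)).2).1 ((Submodule.mem_iInf _).1 hv x)
      obtain ⟨a, ha⟩ := exists_torusWeight_of_eigenvector hγ hv0 hev
      have ha0 : a = 0 := by
        by_contra h
        exact hcon a h ⟨v, hv0, fun y => by rw [hev, ha]⟩
      rw [hev, ha, ha0]
      simp
    have := hle (Submodule.mem_top (x := v))
    rwa [Module.End.mem_eigenspace_iff, toLin'_apply, one_smul] at this
  have hone : ∀ x : Fin n → ℝ, suTorus x = 1 := by
    intro x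
    apply γ.injective
    rw [map_one]
    apply Subtype.ext
    apply Matrix.ext_of_mulVec_single
    intro i
    rw [hfix]
    exact (one_mulVec _).symm
  have h1 := (suTorus_single_sub_single_eq_one_iff (i := (⟨0, by omega⟩ : Fin n))
    (j := ⟨1, by omega⟩) (by simp) Real.pi).1 (hone _)
  rw [mul_comm, Complex.exp_pi_mul_I] at h1
  norm_num at h1

/-- Up to sign and ordering, the weights of `γ` are those of the standard representation. -/
theorem exists_forall_isTorusWeight (hn : 2 ≤ n) (hγ : Continuous γ) :
    ∃ m : ℝ, m ≠ 0 ∧ ∀ j, ∃ v : Fin n → ℂ, v ≠ 0 ∧ ∀ x : Fin n → ℝ, (γ (suTorus x)).1 *ᵥ v =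
      Complex.exp (Complex.I * (m * (x j - (∑ k, x k) / n) : ℝ)) • v := by
  obtain ⟨a, ha0, ha⟩ := exists_isTorusWeight_ne_zero hn hγ
  have hnR : (n : ℝ) ≠ 0 := Nat.cast_ne_zero.2 (NeZero.ne n)
  have hnc : ∃ i j, a i ≠ a j := by
    by_contra! h
    apply ha0
    ext i
    have h1 := ha.sum_eq_zero
    rw [Finset.sum_congr rfl fun j _ => h j i, Finset.sum_const, Finset.card_univ,
      Fintype.card_fin, nsmul_eq_mul] at h1
    exact (mul_eq_zero.1 h1).resolve_left hnR
  obtain ⟨j, c, d, hcd, hupd⟩ := exists_eq_update_of_card_rearrangements_le a hnc <| by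
    refine card_le_of_forall_isTorusWeight (γ := γ) _ fun b hb => ?_
    obtain ⟨σ, -, rfl⟩ := Finset.mem_image.1 hb
    exact ha.comp_perm σ
  have hak : ∀ k, a k = c + Pi.single (M := fun _ => ℝ) j (d - c) k := by
    intro k
    rw [hupd]
    by_cases hk : k = j
    · subst hk; simp
    · simp [hk]
  have hsum : n * c + (d - c) = 0 := by
    have h1 := ha.sum_eq_zero
    rw [Finset.sum_congr rfl fun k _ => hak k, Finset.sum_add_distrib] at h1
    simpa using h1
  refine ⟨d - c, sub_ne_zero.2 hcd.symm, fun i => ?_⟩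
  obtain ⟨v, hv0, hv⟩ := ha.comp_perm (Equiv.swap i j)
  refine ⟨v, hv0, fun x => ?_⟩
  rw [hv]
  congr 4
  have hswap : ∀ k, (a ∘ Equiv.swap i j) k * x k =
      c * x k + Pi.single (M := fun _ => ℝ) i (d - c) k * x k := by
    intro k
    rw [Function.comp, hak, ← add_mul]
    congr 2
    by_cases hk : k = i
    · subst hk; simp
    · have : Equiv.swap i j k ≠ j := fun h => hk (by
        rw [Equiv.swap_apply_eq_iff, Equiv.swap_apply_right] at h; exact h)
      rw [Pi.single_eq_of_ne this, Pi.single_eq_of_ne hk]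
  have hsingle : ∑ k, Pi.single (M := fun _ => ℝ) i (d - c) k * x k = (d - c) * x i := by
    rw [Finset.sum_eq_single i (fun k _ hk => by simp [hk]) (by simp), Pi.single_eq_same]
  rw [Finset.sum_congr rfl fun k _ => hswap k, Finset.sum_add_distrib, ← Finset.mul_sum,
    hsingle]
  field_simp
  linear_combination (∑ k, x k) * hsum

theorem exists_suTorus_eq_conj_smul (hn : 2 ≤ n) (hγ : Continuous γ) :
    ∃ (m : ℝ) (V : Matrix (Fin n) (Fin n) ℂ), m ≠ 0 ∧ IsUnit V ∧
      ∀ x : Fin n → ℝ, (γ (suTorus x)).1 * V = V * (suTorus (m • x)).1 := by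
  obtain ⟨m, hm, hw⟩ := exists_forall_isTorusWeight hn hγ
  choose v hv0 hv using hw
  set a : Fin n → Fin n → ℝ := fun j k => Pi.single (M := fun _ => ℝ) j m k - m / n with ha
  have hsum : ∀ j (x : Fin n → ℝ), ∑ k, a j k * x k = m * (x j - (∑ k, x k) / n) := by
    intro j x
    simp only [ha, sub_mul, Finset.sum_sub_distrib, ← Finset.mul_sum]
    rw [Finset.sum_eq_single j (fun k _ hk => by simp [hk]) (by simp), Pi.single_eq_same]
    ring
  have hinj : Function.Injective a := by
    intro i j hij
    by_contra hne
    have h1 := congrFun hij i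
    simp only [ha, Pi.single_eq_same, Pi.single_eq_of_ne hne] at h1
    exact hm (by linarith)
  have hind := linearIndependent_of_torusWeights (γ := γ) hinj hv0 fun j x => by rw [hv, hsum]
  have hunit : IsUnit (Matrix.of v) := linearIndependent_rows_iff_isUnit.1 hind
  refine ⟨m, (Matrix.of v)ᵀ, hm, (isUnit_transpose _).2 hunit, fun x => ?_⟩
  ext i j
  have h1 := congrFun (hv j x) i
  rw [suTorus_val, mul_diagonal, mul_comm ((Matrix.of v)ᵀ i j)]
  refine h1.trans ?_
  rw [Pi.smul_apply, smul_eq_mul, transpose_apply, of_apply]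
  simp only [Pi.smul_apply, smul_eq_mul, ← Finset.mul_sum, mul_sub, mul_div_assoc]

theorem Real.exists_int_of_exp_I_mul_two_pi_mul_eq_one {t : ℝ}
    (h : Complex.exp (Complex.I * (t * (2 * Real.pi) : ℝ)) = 1) : ∃ k : ℤ, t = k := by
  obtain ⟨k, hk⟩ := Complex.exp_eq_one_iff.1 h
  refine ⟨k, ?_⟩
  have h1 := congrArg Complex.im hk
  simpa using h1

/-- On the torus, `γ` preserves the trace or conjugates it. -/
theorem trace_apply_suTorus (hn : 2 ≤ n) (hγ : Continuous γ) :
    (∀ x, (γ (suTorus x)).1.trace = (suTorus x).1.trace) ∨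
      ∀ x, (γ (suTorus x)).1.trace = star (suTorus x).1.trace := by
  obtain ⟨m, V, hm, hV, h⟩ := exists_suTorus_eq_conj_smul hn hγ
  have htrace : ∀ x, (γ (suTorus x)).1.trace = (suTorus (m • x)).1.trace := fun x => by
    have hdet := (isUnit_iff_isUnit_det V).1 hV
    have h1 : (γ (suTorus x)).1 = V * (suTorus (m • x)).1 * V⁻¹ := by
      rw [← h, mul_assoc, mul_nonsing_inv _ hdet, mul_one]
    rw [h1, trace_mul_comm, ← mul_assoc, nonsing_inv_mul _ hdet, one_mul]
  have hone : ∀ x : Fin n → ℝ, suTorus x = 1 ↔ suTorus (m • x) = 1 := by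
    intro x
    rw [← map_eq_one_iff γ γ.injective, ← Subtype.coe_inj, ← Subtype.coe_inj]
    change _ = (1 : Matrix (Fin n) (Fin n) ℂ) ↔ _ = (1 : Matrix (Fin n) (Fin n) ℂ)
    rw [← hV.mul_left_inj, h, one_mul, ← hV.mul_right_inj (b := (suTorus (m • x)).1), mul_one]
  have hexp : ∀ s : ℝ, Complex.exp (Complex.I * s) = 1 ↔
      Complex.exp (Complex.I * (m * s : ℝ)) = 1 := by
    intro s
    have hij : (⟨0, by omega⟩ : Fin n) ≠ ⟨1, by omega⟩ := by simp
    rw [← suTorus_single_sub_single_eq_one_iff hij, ← suTorus_single_sub_single_eq_one_iff hij,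
      hone, smul_sub, ← Pi.single_smul, ← Pi.single_smul, smul_eq_mul]
  have h2pi : Complex.exp (Complex.I * (2 * Real.pi : ℝ)) = 1 := by
    rw [mul_comm, Complex.ofReal_mul, Complex.ofReal_ofNat, Complex.exp_two_pi_mul_I]
  obtain ⟨k, hk⟩ := Real.exists_int_of_exp_I_mul_two_pi_mul_eq_one ((hexp _).1 h2pi)
  obtain ⟨l, hl⟩ := Real.exists_int_of_exp_I_mul_two_pi_mul_eq_one (t := m⁻¹) <|
    (hexp _).2 (by rw [mul_inv_cancel_left₀ hm, h2pi])
  have hkl : k * l = 1 := by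
    have : (k * l : ℝ) = 1 := by rw [← hk, ← hl, mul_inv_cancel₀ hm]
    exact_mod_cast this
  rcases Int.eq_one_or_neg_one_of_mul_eq_one hkl with rfl | rfl
  · left
    intro x
    rw [htrace, hk, Int.cast_one, one_smul]
  · right
    intro x
    have h3 : suTorus (m • x) = star (suTorus x) := by
      rw [Matrix.star_eq_inv, eq_inv_iff_mul_eq_one, ← suTorus_add, hk]
      convert suTorus_eq_one_of_const (n := n) 0 using 2
      ext j
      simp
    rw [htrace, h3, specialUnitaryGroup.coe_star, star_eq_conjTranspose, trace_conjTranspose]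

/-- `γ` preserves all traces or conjugates them all. -/
theorem trace_apply_specialUnitary (hn : 2 ≤ n) (hγ : Continuous γ) :
    (∀ B, (γ B).1.trace = B.1.trace) ∨ ∀ B, (γ B).1.trace = star B.1.trace := by
  have hconj : ∀ P B : specialUnitaryGroup (Fin n) ℂ, (P * B * P⁻¹).1.trace = B.1.trace := by
    intro P B
    change ((P * B).1 * (P⁻¹).1).trace = _
    rw [trace_mul_comm]
    change (P⁻¹ * (P * B)).1.trace = _
    rw [inv_mul_cancel_left]
  refine (trace_apply_suTorus hn hγ).imp (fun h B => ?_) fun h B => ?_ <;>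
  · obtain ⟨P, x, rfl⟩ := exists_eq_conj_suTorus B
    rw [map_mul, map_mul, map_inv, hconj, hconj, h]

end

/-- Entrywise complex conjugation as an automorphism of `SU_n`. -/
def conjSU (n : ℕ) : specialUnitaryGroup (Fin n) ℂ ≃* specialUnitaryGroup (Fin n) ℂ where
  toFun B := ⟨B.1.map (starRingEnd ℂ), by
    obtain ⟨h1, h2⟩ := mem_specialUnitaryGroup_iff.1 B.2
    refine mem_specialUnitaryGroup_iff.2 ⟨map_star_mem_unitaryGroup_iff.2 h1, ?_⟩
    rw [← RingHom.mapMatrix_apply, ← RingHom.map_det, h2, map_one]⟩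
  invFun B := ⟨B.1.map (starRingEnd ℂ), by
    obtain ⟨h1, h2⟩ := mem_specialUnitaryGroup_iff.1 B.2
    refine mem_specialUnitaryGroup_iff.2 ⟨map_star_mem_unitaryGroup_iff.2 h1, ?_⟩
    rw [← RingHom.mapMatrix_apply, ← RingHom.map_det, h2, map_one]⟩
  left_inv B := Subtype.ext (by ext; simp)
  right_inv B := Subtype.ext (by ext; simp)
  map_mul' A B := Subtype.ext (Matrix.map_mul (f := starRingEnd ℂ))

/-- For `n ≥ 2`, every topological group automorphism `γ` of `SU_n` is either
`B ↦ h₀·B·h₀⁻¹` or `B ↦ h₀·B̄·h₀⁻¹` for some fixed `h₀ ∈ SU_n`, where `B̄` is the entrywise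
complex conjugate of `B`. -/
theorem automorphism_of_su_inner_or_conj_inner (n : ℕ) (hn : 2 ≤ n)
    (γ : Matrix.specialUnitaryGroup (Fin n) ℂ ≃* Matrix.specialUnitaryGroup (Fin n) ℂ)
    (hγ : Continuous γ) (hγs : Continuous γ.symm) :
    (∃ h₀ : Matrix.specialUnitaryGroup (Fin n) ℂ,
      ∀ B : Matrix.specialUnitaryGroup (Fin n) ℂ,
        (γ B : Matrix (Fin n) (Fin n) ℂ) =
          (h₀ : Matrix (Fin n) (Fin n) ℂ) * (B : Matrix (Fin n) (Fin n) ℂ) *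
            (h₀ : Matrix (Fin n) (Fin n) ℂ)⁻¹) ∨
    (∃ h₀ : Matrix.specialUnitaryGroup (Fin n) ℂ,
      ∀ B : Matrix.specialUnitaryGroup (Fin n) ℂ,
        (γ B : Matrix (Fin n) (Fin n) ℂ) =
          (h₀ : Matrix (Fin n) (Fin n) ℂ) *
            ((B : Matrix (Fin n) (Fin n) ℂ).map (starRingEnd ℂ)) *
            (h₀ : Matrix (Fin n) (Fin n) ℂ)⁻¹) := by
  have : NeZero n := ⟨by omega⟩
  have hinv : ∀ h : specialUnitaryGroup (Fin n) ℂ, (h⁻¹).1 = (h.1)⁻¹ := fun h =>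
    (inv_eq_left_inv (mem_unitaryGroup_iff'.1 (mem_specialUnitaryGroup_iff.1 h.2).1)).symm
  rcases trace_apply_specialUnitary hn hγ with htr | htr
  · left
    obtain ⟨h, hh⟩ := exists_conj_of_trace_eq (NeZero.ne n) γ htr
    refine ⟨h, fun B => ?_⟩
    rw [hh, ← hinv]
    rfl
  · right
    obtain ⟨h, hh⟩ := exists_conj_of_trace_eq (NeZero.ne n) ((conjSU n).trans γ) fun B => by
      rw [MulEquiv.trans_apply, htr]
      simp [conjSU, trace]
    refine ⟨h, fun B => ?_⟩
    have h1 := hh ((conjSU n).symm B)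
    rw [MulEquiv.trans_apply, MulEquiv.apply_symm_apply] at h1
    rw [h1, ← hinv]
    rfl
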